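/- Let σ_H, σ_W > 0 and set σ = √(σ_H² + σ_W²). Then for every real z > 2σ: (σ_H²·𝔤_σ(z)³ / (1 − σ_H²·𝔤_σ(z)²)²) · (1 − σ_W²·𝔤_σ′(z)) + (σ_W²/2) · 𝔤_σ″(z) / (1 − σ_W²·𝔤_σ′(z)) = σ²·𝔤_σ(z)³ / (1 − σ²·𝔤_σ(z)²)², where 𝔤_σ′ and 𝔤_σ″ denote the first and second derivatives of 𝔤_σ; moreover all denominators appearing in this identity are nonzero for z > 2σ. -/

import Mathlib

/-- The Stieltjes transform of the semicircle law of variance `s ^ 2`,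
    `𝔤_s(l) = (l - sign(l) * √(l² - 4 s²)) / (2 s²)`, for real `l` with `|l| > 2 s`. -/
noncomputable def stieltjes (s l : ℝ) : ℝ :=
  (l - Real.sign l * Real.sqrt (l ^ 2 - 4 * s ^ 2)) / (2 * s ^ 2)

open Filter Topology

lemma stieltjes_of_pos (s : ℝ) {z : ℝ} (hz : 0 < z) :
    stieltjes s z = (z - √(z ^ 2 - 4 * s ^ 2)) / (2 * s ^ 2) := by
  rw [stieltjes, Real.sign_of_pos hz, one_mul]

lemma sq_sub_pos_of_two_mul_lt {s z : ℝ} (hs : 0 < s) (hz : 2 * s < z) :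
    0 < z ^ 2 - 4 * s ^ 2 := by nlinarith

lemma stieltjes_pos {s z : ℝ} (hs : 0 < s) (hz : 2 * s < z) : 0 < stieltjes s z := by
  have hz0 : 0 < z := by linarith
  rw [stieltjes_of_pos s hz0]
  have : √(z ^ 2 - 4 * s ^ 2) < z := (Real.sqrt_lt' hz0).2 (by nlinarith)
  have : 0 < z - √(z ^ 2 - 4 * s ^ 2) := by linarith
  positivity

lemma one_sub_sq_mul_stieltjes_sq {s z : ℝ} (hs : 0 < s) (hz : 2 * s < z) :
    1 - s ^ 2 * stieltjes s z ^ 2 = stieltjes s z * √(z ^ 2 - 4 * s ^ 2) := by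
  rw [stieltjes_of_pos s (by linarith)]
  have hr := Real.sq_sqrt (sq_sub_pos_of_two_mul_lt hs hz).le
  generalize √(z ^ 2 - 4 * s ^ 2) = r at *
  field_simp
  linear_combination hr

lemma one_sub_sq_mul_stieltjes_sq_pos {s z : ℝ} (hs : 0 < s) (hz : 2 * s < z) :
    0 < 1 - s ^ 2 * stieltjes s z ^ 2 := by
  rw [one_sub_sq_mul_stieltjes_sq hs hz]
  exact mul_pos (stieltjes_pos hs hz) (Real.sqrt_pos.2 (sq_sub_pos_of_two_mul_lt hs hz))

lemma hasDerivAt_stieltjes {s z : ℝ} (hs : 0 < s) (hz : 2 * s < z) :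
    HasDerivAt (stieltjes s) (-stieltjes s z ^ 2 / (1 - s ^ 2 * stieltjes s z ^ 2)) z := by
  have hz0 : 0 < z := by linarith
  have hd := sq_sub_pos_of_two_mul_lt hs hz
  have hr : √(z ^ 2 - 4 * s ^ 2) ≠ 0 := (Real.sqrt_pos.2 hd).ne'
  have hg := (stieltjes_pos hs hz).ne'
  have hq : HasDerivAt (fun x : ℝ => x ^ 2 - 4 * s ^ 2) (2 * z) z := by
    simpa using (hasDerivAt_pow 2 z).sub_const (4 * s ^ 2)
  have h := ((hasDerivAt_id z).sub (hq.sqrt hd.ne')).div_const (2 * s ^ 2)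
  have heq : stieltjes s =ᶠ[𝓝 z]
      fun x => (x - √(x ^ 2 - 4 * s ^ 2)) / (2 * s ^ 2) := by
    filter_upwards [lt_mem_nhds hz0] with x hx using stieltjes_of_pos s hx
  refine (h.congr_of_eventuallyEq heq).congr_deriv ?_
  rw [one_sub_sq_mul_stieltjes_sq hs hz, sq (stieltjes s z), neg_div, mul_div_mul_left _ _ hg,
    stieltjes_of_pos s hz0]
  field_simp
  ring

lemma hasDerivAt_deriv_stieltjes {s z : ℝ} (hs : 0 < s) (hz : 2 * s < z) :
    HasDerivAt (deriv (stieltjes s))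
      (2 * stieltjes s z ^ 3 / (1 - s ^ 2 * stieltjes s z ^ 2) ^ 3) z := by
  have hD := (one_sub_sq_mul_stieltjes_sq_pos hs hz).ne'
  have hg := (hasDerivAt_stieltjes hs hz).pow 2
  have heq : deriv (stieltjes s) =ᶠ[𝓝 z]
      fun x => -stieltjes s x ^ 2 / (1 - s ^ 2 * stieltjes s x ^ 2) := by
    filter_upwards [lt_mem_nhds hz] with x hx using (hasDerivAt_stieltjes hs hx).deriv
  refine ((hg.neg.div ((hg.const_mul (s ^ 2)).const_sub 1) hD).congr_of_eventuallyEq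
    heq).congr_deriv ?_
  simp only [Pi.pow_apply, Pi.neg_apply]
  field_simp
  ring

theorem stmt_14 (σH σW σ : ℝ) (hσH : 0 < σH) (hσW : 0 < σW)
    (hσ : σ = Real.sqrt (σH ^ 2 + σW ^ 2)) :
    ∀ z : ℝ, 2 * σ < z →
      (σH ^ 2 * stieltjes σ z ^ 3 / (1 - σH ^ 2 * stieltjes σ z ^ 2) ^ 2) *
          (1 - σW ^ 2 * deriv (stieltjes σ) z) +
        (σW ^ 2 / 2) * deriv (deriv (stieltjes σ)) z / (1 - σW ^ 2 * deriv (stieltjes σ) z)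
        = σ ^ 2 * stieltjes σ z ^ 3 / (1 - σ ^ 2 * stieltjes σ z ^ 2) ^ 2 ∧
      1 - σH ^ 2 * stieltjes σ z ^ 2 ≠ 0 ∧
      1 - σW ^ 2 * deriv (stieltjes σ) z ≠ 0 ∧
      1 - σ ^ 2 * stieltjes σ z ^ 2 ≠ 0 := by
  intro z hz
  have hs : 0 < σ := hσ ▸ Real.sqrt_pos.2 (by positivity)
  have hs2 : σ ^ 2 = σH ^ 2 + σW ^ 2 := by rw [hσ, Real.sq_sqrt (by positivity)]
  have hD := one_sub_sq_mul_stieltjes_sq_pos hs hz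
  rw [(hasDerivAt_deriv_stieltjes hs hz).deriv, (hasDerivAt_stieltjes hs hz).deriv]
  generalize stieltjes σ z = g at *
  have hH : 0 < 1 - σH ^ 2 * g ^ 2 := by
    rw [hs2] at hD
    nlinarith [mul_nonneg (sq_nonneg σW) (sq_nonneg g)]
  have hW : 1 - σW ^ 2 * (-g ^ 2 / (1 - σ ^ 2 * g ^ 2)) =
      (1 - σH ^ 2 * g ^ 2) / (1 - σ ^ 2 * g ^ 2) := by
    rw [eq_div_iff hD.ne', sub_mul, mul_assoc, div_mul_cancel₀ _ hD.ne', hs2]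
    ring
  refine ⟨?_, hH.ne', ?_, hD.ne'⟩
  · have hD' := hD.ne'
    have hH' := hH.ne'
    rw [hW]
    have hsum : σH ^ 2 * (1 - σ ^ 2 * g ^ 2) + σW ^ 2 = σ ^ 2 * (1 - σH ^ 2 * g ^ 2) := by
      rw [hs2]
      ring
    generalize 1 - σ ^ 2 * g ^ 2 = D at *
    generalize 1 - σH ^ 2 * g ^ 2 = E at *
    field_simp
    linear_combination g ^ 3 * hsum
  · rw [hW]
    exact (div_pos hH hD).ne'
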